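/- arXiv:2502.08212 — 2 statements merged into one kernel-verified Lean document; each statement's English description precedes it below -/
import Mathlib

section
/- Let E be a finite-dimensional real inner product space and let G : E × E → ℝ be a continuously differentiable function that is symmetric, G(x,y) = G(y,x) for all x, y. Suppose G is geodesically decreasing, i.e., for every x ∈ E and every v ∈ E the function s ↦ G(x, x + s·v) is non-increasing on [0, ∞). Then the function x ↦ G(x,x) is constant on E. -/
/-- If both partial maps `G (x, ·)` and `G (·, x)` are maximal at the diagonal point `(x, x)`,
the derivative of `G` vanishes there. -/
theorem fderiv_diagonal_eq_zero_of_partial_max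
    {E : Type*} [NormedAddCommGroup E] [NormedSpace ℝ E] {G : E × E → ℝ} {x : E}
    (hG : DifferentiableAt ℝ G (x, x))
    (hright : ∀ y, G (x, y) ≤ G (x, x)) (hleft : ∀ y, G (y, x) ≤ G (x, x)) :
    fderiv ℝ G (x, x) = 0 := by
  have hr : (fderiv ℝ G (x, x)).comp (ContinuousLinearMap.inr ℝ E E) = 0 :=
    IsLocalMax.hasFDerivAt_eq_zero (f := fun y => G (x, y)) (a := x)
      (Filter.Eventually.of_forall hright)
      (hG.hasFDerivAt.comp x (hasFDerivAt_prodMk_right x x))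
  have hl : (fderiv ℝ G (x, x)).comp (ContinuousLinearMap.inl ℝ E E) = 0 :=
    IsLocalMax.hasFDerivAt_eq_zero (f := fun y => G (y, x)) (a := x)
      (Filter.Eventually.of_forall hleft)
      (hG.hasFDerivAt.comp (f := fun y => (y, x)) x (hasFDerivAt_prodMk_left x x))
  exact ContinuousLinearMap.prod_ext (by simpa using hl) (by simpa using hr)

/-- A symmetric, geodesically decreasing `C¹` function `G` on `E × E` (for a Euclidean
space `E`, where the minimal geodesics are the straight segments) has constant diagonal
`x ↦ G(x,x)`. -/
theorem diagonal_constant_of_symmetric_geodesically_decreasing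
    {E : Type*} [NormedAddCommGroup E] [InnerProductSpace ℝ E] [FiniteDimensional ℝ E]
    (G : E × E → ℝ) (hC1 : ContDiff ℝ 1 G)
    (hsym : ∀ x y : E, G (x, y) = G (y, x))
    (hmono : ∀ x v : E, AntitoneOn (fun s : ℝ => G (x, x + s • v)) (Set.Ici 0)) :
    ∀ x y : E, G (x, x) = G (y, y) := by
  have hmax : ∀ x y, G (x, y) ≤ G (x, x) := fun x y => by
    simpa using hmono x (y - x) (Set.mem_Ici.2 le_rfl) (Set.mem_Ici.2 zero_le_one) zero_le_one
  have hdiff : Differentiable ℝ G := hC1.differentiable (by norm_num)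
  have hdiag : ∀ x, HasFDerivAt (fun x => G (x, x)) (0 : E →L[ℝ] ℝ) x := fun x => by
    have h := (hdiff (x, x)).hasFDerivAt
    rw [fderiv_diagonal_eq_zero_of_partial_max (hdiff (x, x)) (hmax x)
      (fun y => hsym y x ▸ hmax x y)] at h
    simpa [Function.comp_def] using h.comp (f := fun y => (y, y)) x
      ((hasFDerivAt_id x).prodMk (hasFDerivAt_id x))
  exact is_const_of_fderiv_eq_zero (fun x => (hdiag x).differentiableAt)
    (fun x => (hdiag x).fderiv)
end

section
/- Fix 0 < ε < 1 and define G : ℝ × ℝ → ℝ by G(x,y) = −|x − y| + ε·(x + y). Then G is symmetric and geodesically decreasing — for every x ∈ ℝ and every v ∈ ℝ the function s ↦ G(x, x + s·v) is non-increasing on [0, ∞) — yet the diagonal function x ↦ G(x,x) = 2εx is not constant. Hence the C¹ differentiability hypothesis in the lemma asserting constancy of the diagonal of a symmetric geodesically decreasing kernel cannot be dropped. -/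
/-- The kernel `G(x,y) = −|x−y| + ε(x+y)` on `ℝ × ℝ`. -/
def Gcounter (ε x y : ℝ) : ℝ := -|x - y| + ε * (x + y)

/-- For `0 < ε < 1`, the kernel `G(x,y) = −|x−y| + ε(x+y)` is symmetric and geodesically
decreasing (along every ray `s ↦ x + s·v`, `s ≥ 0`, the function `s ↦ G(x, x+s·v)` is
non-increasing), yet its diagonal `x ↦ G(x,x) = 2εx` is not constant.  Hence the `C¹`
hypothesis in the lemma on constancy of the diagonal cannot be dropped. -/
theorem counterexample_diagonal_not_constant (ε : ℝ) (hε0 : 0 < ε) (hε1 : ε < 1) :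
    (∀ x y : ℝ, Gcounter ε x y = Gcounter ε y x) ∧
    (∀ x v : ℝ, AntitoneOn (fun s : ℝ => Gcounter ε x (x + s * v)) (Set.Ici 0)) ∧
    ¬ (∀ x y : ℝ, Gcounter ε x x = Gcounter ε y y) := by
  refine ⟨fun x y => ?_, fun x v a ha b hb hab => ?_, fun h => ?_⟩
  · simp only [Gcounter, abs_sub_comm x y, add_comm x y]
  · have hG : ∀ s ∈ Set.Ici (0 : ℝ),
        Gcounter ε x (x + s * v) = 2 * ε * x - s * (|v| - ε * v) := by
      intro s hs
      rw [Gcounter, sub_add_cancel_left, abs_neg, abs_mul, abs_of_nonneg (Set.mem_Ici.mp hs)]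
      ring
    have hv : 0 ≤ |v| - ε * v := by
      nlinarith [le_abs_self v, abs_nonneg v]
    change Gcounter ε x (x + b * v) ≤ Gcounter ε x (x + a * v)
    rw [hG a ha, hG b hb]
    gcongr
  · have h01 := h 0 1
    norm_num [Gcounter] at h01
    exact hε0.ne' h01
end
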